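/- arXiv:2504.19806 — 3 statements merged into one kernel-verified Lean document; each statement's English description precedes it below -/
import Mathlib

section
/- Let E be a real inner product space, let u, w ∈ E with w ≠ 0, and let ρ ≥ 0. Define the Lagrange multiplier λ* = max((ρ - ⟨w, u⟩)/‖w‖², 0) and the direction d* = -u - λ*·w. Then d* is the unique minimizer of the quadratic objective d ↦ ⟨u, d⟩ + (1/2)‖d‖² over the feasible set {d ∈ E : ⟨w, d⟩ ≤ -ρ}; that is, ⟨w, d*⟩ ≤ -ρ, and for every d ∈ E with ⟨w, d⟩ ≤ -ρ one has ⟨u, d*⟩ + (1/2)‖d*‖² ≤ ⟨u, d⟩ + (1/2)‖d‖², with equality if and only if d = d*. -/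
open scoped RealInnerProductSpace

/-- Expansion of the quadratic objective `x ↦ ⟪u, x⟫ + ‖x‖² / 2` around the point `-u - l • w`. -/
theorem inner_add_half_norm_sq_eq {E : Type*} [NormedAddCommGroup E] [InnerProductSpace ℝ E]
    (u w d : E) (l : ℝ) :
    ⟪u, d⟫ + (1 / 2) * ‖d‖ ^ 2 =
      ⟪u, -u - l • w⟫ + (1 / 2) * ‖-u - l • w‖ ^ 2 + (1 / 2) * ‖d - (-u - l • w)‖ ^ 2
        + l * (⟪w, -u - l • w⟫ - ⟪w, d⟫) := by
  simp only [← real_inner_self_eq_norm_sq, inner_sub_left, inner_sub_right, inner_neg_left,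
    inner_neg_right, real_inner_smul_left, real_inner_smul_right, real_inner_comm u w,
    real_inner_comm u d, real_inner_comm w d]
  ring

/-- Closed-form solution of the descent-direction subproblem:
`d* = -u - λ*·w` with `λ* = max((ρ - ⟨w,u⟩)/‖w‖², 0)` is the unique minimizer of
`d ↦ ⟨u,d⟩ + (1/2)‖d‖²` over `{d : ⟨w,d⟩ ≤ -ρ}`. -/
theorem descent_direction_closed_form
    {E : Type*} [NormedAddCommGroup E] [InnerProductSpace ℝ E]
    (u w : E) (hw : w ≠ 0) (ρ : ℝ) (hρ : 0 ≤ ρ)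
    (lam : ℝ) (hlam : lam = max ((ρ - ⟪w, u⟫) / ‖w‖ ^ 2) 0)
    (dstar : E) (hd : dstar = -u - lam • w) :
    ⟪w, dstar⟫ ≤ -ρ ∧
      ∀ d : E, ⟪w, d⟫ ≤ -ρ →
        (⟪u, dstar⟫ + (1 / 2) * ‖dstar‖ ^ 2 ≤ ⟪u, d⟫ + (1 / 2) * ‖d‖ ^ 2 ∧
          (⟪u, dstar⟫ + (1 / 2) * ‖dstar‖ ^ 2 = ⟪u, d⟫ + (1 / 2) * ‖d‖ ^ 2 ↔ d = dstar)) := by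
  have hw2 : 0 < ‖w‖ ^ 2 := pow_pos (norm_pos_iff.mpr hw) 2
  have hlam_nonneg : 0 ≤ lam := hlam ▸ le_max_right _ _
  have hinner : ⟪w, dstar⟫ = -⟪w, u⟫ - lam * ‖w‖ ^ 2 := by
    rw [hd, inner_sub_right, inner_neg_right, real_inner_smul_right, real_inner_self_eq_norm_sq]
  have hfeas : ⟪w, dstar⟫ ≤ -ρ := by
    have h : (ρ - ⟪w, u⟫) / ‖w‖ ^ 2 ≤ lam := hlam ▸ le_max_left _ _
    rw [div_le_iff₀ hw2] at h
    linarith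
  have hslack : lam * (⟪w, dstar⟫ + ρ) = 0 := by
    rcases max_choice ((ρ - ⟪w, u⟫) / ‖w‖ ^ 2) 0 with h | h
    · have hlam_mul : lam * ‖w‖ ^ 2 = ρ - ⟪w, u⟫ := by
        rw [hlam, h, div_mul_cancel₀ _ hw2.ne']
      rw [hinner, hlam_mul]
      ring
    · rw [hlam, h, zero_mul]
  refine ⟨hfeas, fun d hdfeas => ?_⟩
  have hexp := inner_add_half_norm_sq_eq u w d lam
  rw [← hd] at hexp
  have hgap : 0 ≤ lam * (⟪w, dstar⟫ - ⟪w, d⟫) := by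
    have h : 0 ≤ lam * (-ρ - ⟪w, d⟫) := mul_nonneg hlam_nonneg (by linarith)
    linarith
  have hsq := sq_nonneg ‖d - dstar‖
  refine ⟨by linarith, fun heq => ?_, fun h => by rw [h]⟩
  have hzero : ‖d - dstar‖ ^ 2 = 0 := by linarith
  rwa [sq_eq_zero_iff, norm_eq_zero, sub_eq_zero] at hzero
end

section
/- Let E be a real inner product space, let u, w ∈ E with w ≠ 0, and let ρ ≥ 0. Define λ* = max((ρ - ⟨w, u⟩)/‖w‖², 0) and d* = -u - λ*·w. Then the pair (d*, λ*) satisfies the Karush–Kuhn–Tucker conditions for minimizing d ↦ ⟨u, d⟩ + (1/2)‖d‖² subject to ⟨w, d⟩ + ρ ≤ 0, namely: (i) stationarity: u + d* + λ*·w = 0; (ii) primal feasibility: ⟨w, d*⟩ + ρ ≤ 0; (iii) dual feasibility: λ* ≥ 0; and (iv) complementary slackness: λ* · (⟨w, d*⟩ + ρ) = 0. -/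
open scoped RealInnerProductSpace

/-- KKT conditions for the descent-direction subproblem: the pair
`(d*, λ*)` with `λ* = max((ρ - ⟨w,u⟩)/‖w‖², 0)` and `d* = -u - λ*·w` satisfies
stationarity, primal feasibility, dual feasibility and complementary slackness
for minimizing `d ↦ ⟨u,d⟩ + (1/2)‖d‖²` subject to `⟨w,d⟩ + ρ ≤ 0`. -/
theorem descent_direction_KKT
    {E : Type*} [NormedAddCommGroup E] [InnerProductSpace ℝ E]
    (u w : E) (hw : w ≠ 0) (ρ : ℝ) (hρ : 0 ≤ ρ)
    (lam : ℝ) (hlam : lam = max ((ρ - ⟪w, u⟫) / ‖w‖ ^ 2) 0)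
    (dstar : E) (hd : dstar = -u - lam • w) :
    u + dstar + lam • w = 0 ∧
      ⟪w, dstar⟫ + ρ ≤ 0 ∧
      0 ≤ lam ∧
      lam * (⟪w, dstar⟫ + ρ) = 0 := by
  have hpos : 0 < ‖w‖ ^ 2 := by positivity
  have hres : ⟪w, dstar⟫ + ρ = (ρ - ⟪w, u⟫) - lam * ‖w‖ ^ 2 := by
    rw [hd, inner_sub_right, inner_neg_right, real_inner_smul_right, real_inner_self_eq_norm_sq]
    ring
  refine ⟨by rw [hd]; abel, ?_, hlam ▸ le_max_right _ _, ?_⟩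
  · rw [hres, sub_nonpos, ← div_le_iff₀ hpos, hlam]
    exact le_max_left _ _
  · rw [hres]
    rcases max_choice ((ρ - ⟪w, u⟫) / ‖w‖ ^ 2) 0 with h | h
    · rw [hlam, h, div_mul_cancel₀ _ hpos.ne', sub_self, mul_zero]
    · rw [hlam, h, zero_mul]
end

section
/- Let E be a real inner product space, let u, w, w̃ ∈ E with w̃ ≠ 0, let M ≥ 0 with ‖u‖ ≤ M, let β ≥ 0, and suppose ‖w‖ ≤ 2‖w̃‖. Define λ = max((β‖w̃‖² - ⟨w̃, u⟩)/‖w̃‖², 0). Then ‖-u - λ·w‖² ≤ 10M² + 8β²‖w̃‖² + 16βM‖w̃‖. -/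
open scoped RealInnerProductSpace

/-- Bound on the stationarity measure `ψ(v) = ‖-∇F(v) - λ∇g(v)‖²` in the proof of
Theorem 1: with `‖u‖ ≤ M`, `‖w‖ ≤ 2‖w̃‖` and
`λ = max((β‖w̃‖² - ⟨w̃,u⟩)/‖w̃‖², 0)`, one has
`‖-u - λ·w‖² ≤ 10M² + 8β²‖w̃‖² + 16βM‖w̃‖`. -/
theorem stationarity_measure_bound
    {E : Type*} [NormedAddCommGroup E] [InnerProductSpace ℝ E]
    (u w wt : E) (hwt : wt ≠ 0)
    (M : ℝ) (hM : 0 ≤ M) (hu : ‖u‖ ≤ M)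
    (β : ℝ) (hβ : 0 ≤ β)
    (hw : ‖w‖ ≤ 2 * ‖wt‖)
    (lam : ℝ) (hlam : lam = max ((β * ‖wt‖ ^ 2 - ⟪wt, u⟫) / ‖wt‖ ^ 2) 0) :
    ‖-u - lam • w‖ ^ 2 ≤ 10 * M ^ 2 + 8 * β ^ 2 * ‖wt‖ ^ 2 + 16 * β * M * ‖wt‖ := by
  have ht : 0 < ‖wt‖ := norm_pos_iff.mpr hwt
  have hlam0 : 0 ≤ lam := hlam ▸ le_max_right _ _
  have hlam_le : lam ≤ (β * ‖wt‖ + M) / ‖wt‖ := by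
    rw [hlam]
    refine max_le ?_ (by positivity)
    rw [div_le_div_iff₀ (by positivity) ht]
    have hinner : -⟪wt, u⟫ ≤ ‖wt‖ * M :=
      (neg_le_abs _).trans ((abs_real_inner_le_norm wt u).trans (by gcongr))
    nlinarith [mul_le_mul_of_nonneg_right hinner ht.le]
  have hlam_norm : lam * ‖wt‖ ≤ β * ‖wt‖ + M := (le_div_iff₀ ht).mp hlam_le
  have hnorm : ‖-u - lam • w‖ ≤ 3 * M + 2 * (β * ‖wt‖) := by
    calc ‖-u - lam • w‖ ≤ ‖-u‖ + ‖lam • w‖ := norm_sub_le _ _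
      _ = ‖u‖ + lam * ‖w‖ := by rw [norm_neg, norm_smul, Real.norm_of_nonneg hlam0]
      _ ≤ M + lam * (2 * ‖wt‖) := by gcongr
      _ ≤ 3 * M + 2 * (β * ‖wt‖) := by linarith
  have hcross : 0 ≤ M * (β * ‖wt‖) := by positivity
  calc ‖-u - lam • w‖ ^ 2 ≤ (3 * M + 2 * (β * ‖wt‖)) ^ 2 := by gcongr
    _ ≤ 10 * M ^ 2 + 8 * β ^ 2 * ‖wt‖ ^ 2 + 16 * β * M * ‖wt‖ := by
      nlinarith [sq_nonneg M, sq_nonneg (β * ‖wt‖)]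
end
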